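/- arXiv:cond-mat/0307308 — 2 statements merged into one kernel-verified Lean document; each statement's English description precedes it below -/
import Mathlib

section
/- Fix a real number α > 0, a real t > 0, an integer K ≥ 1, and integers 0 = n_0 < n_1 < ⋯ < n_K < n_{K+1}. Let f : ℝ^{K+1} → ℝ equal, on tuples with x_1 > x_2 > ⋯ > x_{K+1} > 0, f(x) = t^{n_{K+1}} · exp(−t·x_{K+1}^{−α}) · ∏_{k=1}^{K+1} [ (x_k^{−α} − x_{k−1}^{−α})^{n_k − n_{k−1} − 1} / Γ(n_k − n_{k−1}) ] · α x_k^{−(1+α)}, with the convention x_0^{−α} = 0, and f(x) = 0 otherwise. Then for all u_1, …, u_K ∈ (0,1]: ∫_{{x : x_1 > ⋯ > x_{K+1} > 0 and x_{k+1} ≤ u_k x_k for k = 1,…,K}} f(x) dx = ∏_{k=1}^K B_{n_k, n_{k+1}−n_k}(u_k^α). -/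
open Real MeasureTheory

open scoped Classical in
/-- The joint probability density (with respect to Lebesgue measure on `ℝ^{K+1}`) of the
`(n 1, …, n (K+1))`-th largest flights up to time `t` of the α-selfsimilar one-sided Lévy
process with flight tail `Λ(x) = x^{-α}`.  The coordinate `x i` represents `x_{i+1}`, and the
convention `x_0^{-α} = 0` is used. -/
noncomputable def flightDensity (α t : ℝ) (K : ℕ) (n : ℕ → ℕ) (x : Fin (K + 1) → ℝ) : ℝ :=
  if StrictAnti x ∧ 0 < x (Fin.last K) then
    t ^ (n (K + 1)) * Real.exp (-t * (x (Fin.last K)) ^ (-α)) *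
      ∏ i : Fin (K + 1),
        (((x i) ^ (-α) - (if (i : ℕ) = 0 then 0 else (x (i - 1)) ^ (-α))) ^
            (n ((i : ℕ) + 1) - n (i : ℕ) - 1) /
          Real.Gamma ((n ((i : ℕ) + 1) - n (i : ℕ) : ℕ)) *
        (α * (x i) ^ (-(1 + α))))
  else 0

/-- The cumulative distribution function of the Beta(n,m) distribution. -/
noncomputable def betaCDF (n m v : ℝ) : ℝ :=
  ∫ s in (0:ℝ)..v, (Real.Gamma (n + m) / (Real.Gamma n * Real.Gamma m)) *
    s ^ (n - 1) * (1 - s) ^ (m - 1)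

open Set in
/-- Change of variables `s = B y ^ (-α)` on the positive half-line. -/
theorem lintegral_Ioi_comp_mul_rpow_neg {α B : ℝ} (hα : 0 < α) (hB : 0 < B) (g : ℝ → ENNReal) :
    ∫⁻ y in Ioi (0 : ℝ), ENNReal.ofReal (B * (α * y ^ (-(1 + α)))) * g (B * y ^ (-α)) =
      ∫⁻ s in Ioi (0 : ℝ), g s := by
  have himage : (fun y : ℝ => B * y ^ (-α)) '' Ioi 0 = Ioi 0 := by
    ext s
    simp only [mem_image, mem_Ioi]
    constructor
    · rintro ⟨y, hy, rfl⟩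
      positivity
    · intro hs
      refine ⟨(s / B) ^ (-α)⁻¹, by positivity, ?_⟩
      rw [Real.rpow_inv_rpow (by positivity) (by simpa using hα.ne')]
      field_simp
  have hinj : InjOn (fun y : ℝ => B * y ^ (-α)) (Ioi 0) := by
    intro y hy z hz h
    exact (Real.rpow_left_inj (le_of_lt hy) (le_of_lt hz) (by simpa using hα.ne')).1
      (mul_left_cancel₀ hB.ne' h)
  have hderiv : ∀ y ∈ Ioi (0 : ℝ), HasDerivWithinAt (fun y : ℝ => B * y ^ (-α))
      (B * (-α * y ^ (-α - 1))) (Ioi 0) y := fun y hy =>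
    ((Real.hasDerivAt_rpow_const (Or.inl (ne_of_gt hy))).const_mul B).hasDerivWithinAt
  have h := lintegral_image_eq_lintegral_abs_deriv_mul measurableSet_Ioi hderiv hinj g
  rw [himage] at h
  rw [h]
  refine setLIntegral_congr_fun measurableSet_Ioi fun y hy => ?_
  have hy' : (0 : ℝ) < y ^ (-α - 1) := Real.rpow_pos_of_pos hy _
  have habs : |B * (-α * y ^ (-α - 1))| = B * (α * y ^ (-(1 + α))) := by
    rw [show -(1 + α) = -α - 1 by ring, abs_mul, abs_mul, abs_neg, abs_of_pos hB, abs_of_pos hα,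
      abs_of_pos hy']
  simp only [habs]

open scoped Classical in
/-- The density `(x ^ (-α)) ^ (a - 1) / Γ(a) · α x ^ (-(1 + α))` on the positive half-line. -/
noncomputable def flightInitial (α : ℝ) (a : ℕ) (x : ℝ) : ENNReal :=
  if 0 < x then
    ENNReal.ofReal ((x ^ (-α)) ^ (a - 1) / Real.Gamma a * (α * x ^ (-(1 + α))))
  else 0

open scoped Classical in
/-- The transition density from a flight `y` to the flight `x < y` of rank higher by `m`,
restricted to `x ≤ u y`. -/
noncomputable def flightTransition (α : ℝ) (m : ℕ) (u y x : ℝ) : ENNReal :=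
  if 0 < x ∧ x < y ∧ x ≤ u * y then
    ENNReal.ofReal ((x ^ (-α) - y ^ (-α)) ^ (m - 1) / Real.Gamma m * (α * x ^ (-(1 + α))))
  else 0

theorem measurable_flightInitial (α : ℝ) (a : ℕ) : Measurable (flightInitial α a) :=
  Measurable.ite measurableSet_Ioi (by fun_prop) measurable_const

theorem measurable_flightTransition (α : ℝ) (m : ℕ) (u : ℝ) :
    Measurable fun z : ℝ × ℝ => flightTransition α m u z.1 z.2 := by
  refine Measurable.ite ?_ (by fun_prop) measurable_const
  exact (measurableSet_lt measurable_const measurable_snd).inter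
    ((measurableSet_lt measurable_snd measurable_fst).inter
      (measurableSet_le measurable_snd (measurable_fst.const_mul u)))

theorem betaCDF_natCast (a m : ℕ) (ha : 0 < a) (hm : 0 < m) (v : ℝ) :
    betaCDF a m v = ∫ s in (0 : ℝ)..v,
      Real.Gamma (a + m) / (Real.Gamma a * Real.Gamma m) * s ^ (a - 1) * (1 - s) ^ (m - 1) := by
  unfold betaCDF
  simp only [← Nat.cast_pred ha, ← Nat.cast_pred hm, Real.rpow_natCast]

theorem betaCDF_nonneg {a m : ℕ} (ha : 0 < a) (hm : 0 < m) {v : ℝ} (hv0 : 0 ≤ v) (hv1 : v ≤ 1) :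
    0 ≤ betaCDF a m v := by
  rw [betaCDF_natCast a m ha hm]
  refine intervalIntegral.integral_nonneg hv0 fun s hs => ?_
  have h0 : 0 ≤ s := hs.1
  have h1 : 0 ≤ 1 - s := by linarith [hs.2]
  have := Real.Gamma_pos_of_pos (Nat.cast_pos.2 ha : (0 : ℝ) < a)
  have := Real.Gamma_pos_of_pos (Nat.cast_pos.2 hm : (0 : ℝ) < m)
  have := Real.Gamma_pos_of_pos (by positivity : (0 : ℝ) < a + m)
  positivity

open Set in
open scoped Classical in
theorem lintegral_beta_eq_ofReal_betaCDF {a m : ℕ} (ha : 0 < a) (hm : 0 < m) {v : ℝ} (hv0 : 0 ≤ v)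
    (hv1 : v ≤ 1) :
    ∫⁻ s in Ioi (0 : ℝ), (if s < 1 ∧ s ≤ v then ENNReal.ofReal
      (Real.Gamma (a + m) / (Real.Gamma a * Real.Gamma m) * s ^ (a - 1) * (1 - s) ^ (m - 1))
      else 0) = ENNReal.ofReal (betaCDF a m v) := by
  have hΓa := Real.Gamma_pos_of_pos (Nat.cast_pos.2 ha : (0 : ℝ) < a)
  have hΓm := Real.Gamma_pos_of_pos (Nat.cast_pos.2 hm : (0 : ℝ) < m)
  have hΓ := Real.Gamma_pos_of_pos (by positivity : (0 : ℝ) < a + m)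
  rw [betaCDF_natCast a m ha hm, intervalIntegral.integral_of_le hv0,
    ofReal_integral_eq_lintegral_ofReal]
  · have hae : ∀ᵐ s : ℝ, s ≠ 1 := by simp [ae_iff]
    rw [← lintegral_indicator measurableSet_Ioi, ← lintegral_indicator measurableSet_Ioc]
    refine lintegral_congr_ae (hae.mono fun s hs => ?_)
    have hlt : s ≤ v → s < 1 := fun h => lt_of_le_of_ne (h.trans hv1) hs
    by_cases h0 : 0 < s <;> by_cases hv : s ≤ v <;> simp [indicator, h0, hv, hlt]
  · exact (Continuous.integrableOn_Icc (by fun_prop)).mono_set Ioc_subset_Icc_self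
  · refine (ae_restrict_iff' measurableSet_Ioc).2 (ae_of_all _ fun s hs => ?_)
    have h0 : 0 ≤ s := hs.1.le
    have h1 : 0 ≤ 1 - s := by linarith [hs.2]
    simp only [Pi.zero_apply]
    positivity

open Set in
/-- Integrating out the larger of two flights yields the Beta distribution of their ratio. -/
theorem lintegral_flightInitial_mul_flightTransition {α : ℝ} (hα : 0 < α) {a m : ℕ} (ha : 0 < a)
    (hm : 0 < m) {u : ℝ} (hu : u ∈ Ioc (0 : ℝ) 1) (x : ℝ) :
    ∫⁻ y, flightInitial α a y * flightTransition α m u y x =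
      ENNReal.ofReal (betaCDF a m (u ^ α)) * flightInitial α (a + m) x := by
  classical
  rcases le_or_gt x 0 with hx | hx
  · simp [flightInitial, flightTransition, hx.not_gt]
  have hΓa := Real.Gamma_pos_of_pos (Nat.cast_pos.2 ha : (0 : ℝ) < a)
  have hΓm := Real.Gamma_pos_of_pos (Nat.cast_pos.2 hm : (0 : ℝ) < m)
  have hΓ := Real.Gamma_pos_of_pos (by positivity : (0 : ℝ) < a + m)
  have hu0 := hu.1
  have hA : 0 < x ^ (-α) := Real.rpow_pos_of_pos hx _
  rw [← lintegral_beta_eq_ofReal_betaCDF ha hm (Real.rpow_nonneg hu.1.le α)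
    (Real.rpow_le_one hu.1.le hu.2 hα.le),
    ← lintegral_Ioi_comp_mul_rpow_neg hα (inv_pos.2 hA), ← lintegral_mul_const',
    ← lintegral_indicator measurableSet_Ioi]
  swap
  · unfold flightInitial
    split_ifs <;> simp
  refine lintegral_congr fun y => ?_
  by_cases hy : 0 < y
  swap
  · simp [flightInitial, hy]
  have hb : 0 < y ^ (-α) := Real.rpow_pos_of_pos hy _
  have hlt : (x ^ (-α))⁻¹ * y ^ (-α) < 1 ↔ x < y := by
    rw [inv_mul_lt_one₀ hA, Real.rpow_lt_rpow_iff_of_neg hy hx (by linarith)]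
  have hle : (x ^ (-α))⁻¹ * y ^ (-α) ≤ u ^ α ↔ x ≤ u * y := by
    have h : u ^ α = (u ^ (-α))⁻¹ := by rw [Real.rpow_neg hu0.le, inv_inv]
    rw [inv_mul_le_iff₀ hA, h, ← div_eq_mul_inv,
      le_div_iff₀ (Real.rpow_pos_of_pos hu0 _), ← Real.mul_rpow hy.le hu0.le,
      Real.rpow_le_rpow_iff_of_neg (by positivity) hx (by linarith), mul_comm]
  simp only [indicator, mem_Ioi, hy, if_true, hlt, hle, flightInitial, flightTransition, hx,
    true_and]
  by_cases hxy : x < y ∧ x ≤ u * y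
  swap
  · simp [hxy]
  have hba : y ^ (-α) < x ^ (-α) :=
    (Real.rpow_lt_rpow_iff_of_neg hy hx (by linarith)).2 hxy.1
  have hc : 0 < y ^ (-(1 + α)) := Real.rpow_pos_of_pos hy _
  have hd : 0 < x ^ (-(1 + α)) := Real.rpow_pos_of_pos hx _
  rw [if_pos hxy, if_pos hxy]
  push_cast
  generalize x ^ (-α) = A at *
  generalize y ^ (-α) = b at *
  generalize y ^ (-(1 + α)) = c at *
  generalize x ^ (-(1 + α)) = d at *
  have hsub : 0 < A - b := sub_pos.2 hba
  have h1 : 0 < 1 - A⁻¹ * b := by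
    rw [sub_pos, inv_mul_lt_one₀ hA]
    exact hba
  rw [← ENNReal.ofReal_mul (by positivity), ← ENNReal.ofReal_mul (by positivity),
    ← ENNReal.ofReal_mul (by positivity)]
  congr 1
  obtain ⟨a, rfl⟩ := Nat.exists_eq_succ_of_ne_zero ha.ne'
  obtain ⟨m, rfl⟩ := Nat.exists_eq_succ_of_ne_zero hm.ne'
  have hfac : 1 - A⁻¹ * b = (A - b) / A := by field_simp
  have hexp : a.succ + m.succ - 1 = a + m + 1 := by omega
  rw [hfac, hexp]
  simp only [Nat.succ_eq_add_one, Nat.add_sub_cancel, div_pow, mul_pow, inv_pow, pow_add, pow_one]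
    at *
  field_simp

theorem measurable_flight_chain (α : ℝ) {e : ℝ → ENNReal} (he : Measurable e) {K : ℕ} (N : ℕ → ℕ)
    (u : Fin K → ℝ) :
    Measurable fun x : Fin (K + 1) → ℝ => flightInitial α (N 0) (x 0) *
      (∏ k : Fin K, flightTransition α (N (k + 1) - N k) (u k) (x k.castSucc) (x k.succ)) *
      e (x (Fin.last K)) := by
  refine (((measurable_flightInitial α _).comp (measurable_pi_apply _)).mul
    (Finset.measurable_fun_prod _ fun k _ => ?_)).mul (he.comp (measurable_pi_apply _))
  have hpair : Measurable fun x : Fin (K + 1) → ℝ => (x k.castSucc, x k.succ) := by fun_prop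
  exact (measurable_flightTransition α _ _).comp hpair

/-- Integrating the chain of transitions against a function of the smallest flight. -/
theorem lintegral_flight_chain {α : ℝ} (hα : 0 < α) (e : ℝ → ENNReal) (he : Measurable e)
    (K : ℕ) (N : ℕ → ℕ) (hN0 : 0 < N 0) (hN : ∀ k < K, N k < N (k + 1)) (u : Fin K → ℝ)
    (hu : ∀ k, u k ∈ Set.Ioc (0 : ℝ) 1) :
    ∫⁻ x : Fin (K + 1) → ℝ, flightInitial α (N 0) (x 0) *
      (∏ k : Fin K, flightTransition α (N (k + 1) - N k) (u k) (x k.castSucc) (x k.succ)) *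
      e (x (Fin.last K)) =
    (∏ k : Fin K, ENNReal.ofReal (betaCDF (N k) (N (k + 1) - N k : ℕ) (u k ^ α))) *
      ∫⁻ x, flightInitial α (N K) x * e x := by
  induction K generalizing N with
  | zero =>
    simp only [Finset.univ_eq_empty, Finset.prod_empty, mul_one, one_mul]
    exact (volume_preserving_funUnique (Fin 1) ℝ).lintegral_comp_emb
      (MeasurableEquiv.measurableEmbedding _) fun x => flightInitial α (N 0) x * e x
  | succ K ih =>
    have hlt := hN 0 K.succ_pos
    have hshift := ih (fun k => N (k + 1)) (hN0.trans hlt) (fun k hk => hN (k + 1) (by omega))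
      (fun k => u k.succ) (fun k => hu k.succ)
    rw [← (volume_preserving_piFinSuccAbove (fun _ : Fin (K + 2) => ℝ) 0).symm.lintegral_comp_emb
      (MeasurableEquiv.measurableEmbedding _), Measure.volume_eq_prod, lintegral_prod_symm,
      Fin.prod_univ_succ, mul_assoc]
    · simp only [Fin.val_zero, Fin.val_succ, zero_add] at hshift ⊢
      rw [← hshift, ← lintegral_const_mul' _ _ ENNReal.ofReal_ne_top]
      refine lintegral_congr fun x => ?_
      have hstep := lintegral_flightInitial_mul_flightTransition hα hN0 (Nat.sub_pos_of_lt hlt)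
        (hu 0) (x 0)
      rw [Nat.add_sub_of_le hlt.le] at hstep
      rw [← mul_assoc, ← mul_assoc, ← hstep, mul_assoc, ← lintegral_mul_const]
      · refine lintegral_congr fun y => ?_
        simp only [MeasurableEquiv.piFinSuccAbove_symm_apply, Fin.insertNthEquiv_apply,
          Fin.insertNth_zero', Fin.prod_univ_succ, Fin.cons_zero, Fin.cons_succ, Fin.castSucc_zero,
          ← Fin.succ_castSucc, ← Fin.succ_last, Fin.val_zero, Fin.val_succ, zero_add]
        ring
      · exact (measurable_flightInitial α _).mul
          ((measurable_flightTransition α _ _).comp (measurable_id.prodMk measurable_const))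
    · refine Measurable.aemeasurable ?_
      exact (measurable_flight_chain α he N u).comp (MeasurableEquiv.measurable _)

open Set in
theorem lintegral_flightInitial_mul_exp {α t : ℝ} (hα : 0 < α) (ht : 0 < t) {a : ℕ} (ha : 0 < a) :
    ∫⁻ x, flightInitial α a x * ENNReal.ofReal (t ^ a * Real.exp (-t * x ^ (-α))) = 1 := by
  have hΓ := Real.Gamma_pos_of_pos (Nat.cast_pos.2 ha : (0 : ℝ) < a)
  rw [← ProbabilityTheory.lintegral_gammaPDF_eq_one (Nat.cast_pos.2 ha : (0 : ℝ) < a) ht]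
  have hIoi : ∫⁻ x, ProbabilityTheory.gammaPDF a t x =
      ∫⁻ x in Ioi (0 : ℝ), ProbabilityTheory.gammaPDF a t x := by
    have hae : ∀ᵐ s : ℝ, s ≠ 0 := by simp [ae_iff]
    rw [← lintegral_indicator measurableSet_Ioi]
    refine lintegral_congr_ae (hae.mono fun s hs => ?_)
    rcases lt_or_gt_of_ne hs with h | h
    · simp [indicator, h.not_gt, ProbabilityTheory.gammaPDF_of_neg h]
    · simp [indicator, h]
  rw [hIoi, ← lintegral_Ioi_comp_mul_rpow_neg hα one_pos, ← lintegral_indicator measurableSet_Ioi]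
  refine lintegral_congr fun x => ?_
  by_cases hx : 0 < x
  swap
  · simp [flightInitial, hx]
  have hb : 0 < x ^ (-α) := Real.rpow_pos_of_pos hx _
  have hc : 0 < x ^ (-(1 + α)) := Real.rpow_pos_of_pos hx _
  simp only [flightInitial, hx, if_true, indicator, mem_Ioi, one_mul,
    ProbabilityTheory.gammaPDF_of_nonneg hb.le]
  rw [← ENNReal.ofReal_mul (by positivity), ← ENNReal.ofReal_mul (by positivity),
    ← Nat.cast_pred ha, Real.rpow_natCast, Real.rpow_natCast, neg_mul]
  congr 1
  ring

theorem indicator_flightDensity_eq_toReal {α t : ℝ} (hα : 0 < α) (ht : 0 < t) {K : ℕ} {n : ℕ → ℕ}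
    (hn0 : n 0 = 0) (hmono : ∀ k ≤ K, n k < n (k + 1)) (u : Fin K → ℝ) (x : Fin (K + 1) → ℝ) :
    {x : Fin (K + 1) → ℝ | (StrictAnti x ∧ 0 < x (Fin.last K)) ∧
        ∀ k : Fin K, x k.succ ≤ u k * x k.castSucc}.indicator (flightDensity α t K n) x =
    (flightInitial α (n 1) (x 0) *
      (∏ k : Fin K,
        flightTransition α (n (k + 2) - n (k + 1)) (u k) (x k.castSucc) (x k.succ)) *
      ENNReal.ofReal (t ^ n (K + 1) * Real.exp (-t * x (Fin.last K) ^ (-α)))).toReal := by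
  have hΓ : ∀ k ≤ K, 0 < Real.Gamma ((n (k + 1) - n k : ℕ) : ℝ) := fun k hk =>
    Real.Gamma_pos_of_pos (Nat.cast_pos.2 (Nat.sub_pos_of_lt (hmono k hk)))
  by_cases hx : x ∈ {x : Fin (K + 1) → ℝ | (StrictAnti x ∧ 0 < x (Fin.last K)) ∧
        ∀ k : Fin K, x k.succ ≤ u k * x k.castSucc}
  · rw [Set.indicator_of_mem hx]
    obtain ⟨⟨hanti, hlast⟩, hratio⟩ := hx
    have hpos : ∀ i, 0 < x i := fun i => hlast.trans_le (hanti.antitone (Fin.le_last i))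
    have hdiff : ∀ k : Fin K, 0 < x k.succ ^ (-α) - x k.castSucc ^ (-α) := fun k =>
      sub_pos.2 ((Real.rpow_lt_rpow_iff_of_neg (hpos _) (hpos _) (by linarith)).2
        (hanti k.castSucc_lt_succ))
    have htrans : ∀ k : Fin K,
        (flightTransition α (n (k + 2) - n (k + 1)) (u k) (x k.castSucc) (x k.succ)).toReal =
        (x k.succ ^ (-α) - x k.castSucc ^ (-α)) ^ (n (k + 2) - n (k + 1) - 1) /
          Real.Gamma ((n (k + 2) - n (k + 1) : ℕ) : ℝ) * (α * x k.succ ^ (-(1 + α))) := by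
      intro k
      have h1 := hΓ (k + 1) (by omega)
      have h2 := hdiff k
      have h3 := Real.rpow_pos_of_pos (hpos k.succ) (-(1 + α))
      rw [flightTransition, if_pos ⟨hpos _, hanti k.castSucc_lt_succ, hratio k⟩,
        ENNReal.toReal_ofReal (by positivity)]
    have h1 : 0 < Real.Gamma (n 1 : ℝ) := by simpa [hn0] using hΓ 0 (Nat.zero_le K)
    have h2 := Real.rpow_pos_of_pos (hpos 0) (-α)
    have h3 := Real.rpow_pos_of_pos (hpos 0) (-(1 + α))
    have hprev : ∀ k : Fin K, k.succ - 1 = k.castSucc := fun k =>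
      sub_eq_of_eq_add (Fin.coeSucc_eq_succ (a := k)).symm
    rw [ENNReal.toReal_mul, ENNReal.toReal_mul, ENNReal.toReal_prod, flightDensity,
      if_pos ⟨hanti, hlast⟩, flightInitial, if_pos (hpos 0),
      ENNReal.toReal_ofReal (by positivity), ENNReal.toReal_ofReal (by positivity),
      Fin.prod_univ_succ]
    simp only [htrans, Fin.val_zero, Fin.val_succ, hprev, hn0, if_true, Nat.succ_ne_zero, if_false,
      zero_add, Nat.sub_zero, sub_zero]
    ring
  · rw [Set.indicator_of_notMem hx]
    symm
    by_contra hne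
    apply hx
    have hne' := left_ne_zero_of_mul (ENNReal.toReal_ne_zero.1 hne).1
    have hinit : 0 < x 0 := by
      by_contra h
      exact left_ne_zero_of_mul hne' (by simp [flightInitial, h])
    have htrans : ∀ k : Fin K,
        0 < x k.succ ∧ x k.succ < x k.castSucc ∧ x k.succ ≤ u k * x k.castSucc := by
      intro k
      by_contra h
      exact Finset.prod_ne_zero_iff.1 (right_ne_zero_of_mul hne') k (Finset.mem_univ k)
        (by simp only [flightTransition, h, if_false])
    refine ⟨⟨Fin.strictAnti_iff_succ_lt.2 fun k => (htrans k).2.1, ?_⟩, fun k => (htrans k).2.2⟩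
    exact Fin.cases hinit (fun k => (htrans k).1) (Fin.last K)

/-- Proposition 3b: the joint law of the consecutive ratios of the `(n 1, …, n (K+1))`-th
largest flights, stated as an identity of integrals against the joint density. -/
theorem multidimensional_hierarchy (α t : ℝ) (hα : 0 < α) (ht : 0 < t)
    (K : ℕ) (hK : 1 ≤ K) (n : ℕ → ℕ) (hn0 : n 0 = 0)
    (hmono : ∀ k ≤ K, n k < n (k + 1))
    (u : Fin K → ℝ) (hu : ∀ k, u k ∈ Set.Ioc (0:ℝ) 1) :
    (∫ x in {x : Fin (K + 1) → ℝ | (StrictAnti x ∧ 0 < x (Fin.last K)) ∧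
        ∀ k : Fin K, x k.succ ≤ u k * x k.castSucc},
      flightDensity α t K n x)
    = ∏ k : Fin K,
        betaCDF (n ((k : ℕ) + 1)) ((n ((k : ℕ) + 2) - n ((k : ℕ) + 1) : ℕ)) ((u k) ^ α) := by
  have hset : MeasurableSet {x : Fin (K + 1) → ℝ | (StrictAnti x ∧ 0 < x (Fin.last K)) ∧
      ∀ k : Fin K, x k.succ ≤ u k * x k.castSucc} := by
    simp only [Fin.strictAnti_iff_succ_lt, measurableSet_setOfPred]
    fun_prop
  have hexp : Measurable fun y : ℝ =>
      ENNReal.ofReal (t ^ n (K + 1) * Real.exp (-t * y ^ (-α))) := by fun_prop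
  have hchain := lintegral_flight_chain hα _ hexp K
    (fun k => n (k + 1)) (by simpa [hn0] using hmono 0 (Nat.zero_le K))
    (fun k hk => hmono (k + 1) hk) u hu
  have hpos : ∀ k ≤ K, 0 < n (k + 1) := fun k hk => (Nat.zero_le _).trans_lt (hmono k hk)
  rw [lintegral_flightInitial_mul_exp hα ht (hpos K le_rfl), mul_one] at hchain
  rw [← integral_indicator hset]
  simp only [indicator_flightDensity_eq_toReal hα ht hn0 hmono]
  rw [integral_toReal]
  · refine (congrArg ENNReal.toReal hchain).trans ?_
    rw [ENNReal.toReal_prod]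
    refine Finset.prod_congr rfl fun k _ => ENNReal.toReal_ofReal ?_
    exact betaCDF_nonneg (hpos k k.2.le) (Nat.sub_pos_of_lt (hmono (k + 1) k.2))
      (Real.rpow_nonneg (hu k).1.le α) (Real.rpow_le_one (hu k).1.le (hu k).2 hα.le)
  · exact (measurable_flight_chain α hexp (fun k => n (k + 1)) u).aemeasurable
  · refine ae_of_all _ fun x => ENNReal.mul_lt_top (ENNReal.mul_lt_top ?_
      (ENNReal.prod_lt_top fun k _ => ?_)) ENNReal.ofReal_lt_top
    · unfold flightInitial
      split_ifs <;> simp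
    · unfold flightTransition
      split_ifs <;> simp
end

section
/- For every real α with 0 < α < 1, there exists a Borel probability measure μ on [0,∞) such that ∫_{[0,∞)} e^{−ωx} dμ(x) = 1/(1 + G_α(ω)) for all real ω ≥ 0. -/
open Real MeasureTheory

/-- For `0 < α < 1`, the function `G_α(ω) = α ∫_0^1 (1 - e^{-ωu}) u^{-(1+α)} du`. -/
noncomputable def Galpha (α ω : ℝ) : ℝ :=
  α * ∫ u in (0:ℝ)..1, (1 - Real.exp (-ω * u)) * u ^ (-(1 + α))

open Filter Topology

/-- The `k`-fold additive convolution power of a measure on `ℝ`. -/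
noncomputable def convPow (ν : Measure ℝ) : ℕ → Measure ℝ
  | 0 => Measure.dirac 0
  | k + 1 => (convPow ν k).conv ν

theorem lintegral_exp_convPow (ν : Measure ℝ) [SFinite ν] (ω : ℝ) (k : ℕ) :
    ∫⁻ x, ENNReal.ofReal (exp (-ω * x)) ∂(convPow ν k) =
      (∫⁻ x, ENNReal.ofReal (exp (-ω * x)) ∂ν) ^ k := by
  induction k with
  | zero => simp [convPow]
  | succ k ih =>
    have hm : Measurable fun x : ℝ => ENNReal.ofReal (exp (-ω * x)) := by fun_prop
    rw [convPow, Measure.lintegral_conv hm, pow_succ, ← ih, ← lintegral_mul_const _ hm]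
    refine lintegral_congr fun x => ?_
    rw [← lintegral_const_mul _ hm]
    refine lintegral_congr fun y => ?_
    rw [← ENNReal.ofReal_mul (exp_nonneg _), ← exp_add, mul_add]

theorem ae_nonneg_convPow {ν : Measure ℝ} [SFinite ν] (hν : ∀ᵐ x ∂ν, 0 ≤ x) (k : ℕ) :
    ∀ᵐ x ∂(convPow ν k), 0 ≤ x := by
  have hset : MeasurableSet {x : ℝ | 0 ≤ x} := measurableSet_Ici
  induction k with
  | zero => simp [convPow]
  | succ k ih =>
    rw [convPow, Measure.conv, ae_map_iff (by fun_prop) hset]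
    filter_upwards [Measure.quasiMeasurePreserving_fst.ae ih,
      Measure.quasiMeasurePreserving_snd.ae hν] with p h1 h2
    exact add_nonneg h1 h2

theorem integrable_exp_neg_mul {μ : Measure ℝ} [IsFiniteMeasure μ] (hμ : ∀ᵐ x ∂μ, 0 ≤ x)
    {ω : ℝ} (hω : 0 ≤ ω) : Integrable (fun x => exp (-ω * x)) μ := by
  refine Integrable.of_bound (by fun_prop) 1 ?_
  filter_upwards [hμ] with x hx
  rw [norm_of_nonneg (exp_nonneg _), exp_le_one_iff]
  nlinarith [mul_nonneg hω hx]

/-- The value at an independent exponential time of the compound Poisson process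
with Lévy measure `ν`. -/
theorem exists_law_of_isFiniteMeasure (ν : Measure ℝ) [IsFiniteMeasure ν]
    (hν : ∀ᵐ x ∂ν, 0 ≤ x) :
    ∃ μ : Measure ℝ, IsProbabilityMeasure μ ∧ (∀ᵐ x ∂μ, 0 ≤ x) ∧
      ∀ ω : ℝ, 0 ≤ ω →
        (∫ x, exp (-ω * x) ∂μ) = 1 / (1 + ∫ x, (1 - exp (-ω * x)) ∂ν) := by
  set c : ℝ := ν.real Set.univ with hc
  have hc0 : 0 ≤ c := measureReal_nonneg
  set r : ENNReal := ENNReal.ofReal (1 + c)⁻¹ with hr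
  set μ : Measure ℝ := r • Measure.sum fun k => r ^ k • convPow ν k with hμ
  have key : ∀ ω : ℝ, 0 ≤ ω → ∫⁻ x, ENNReal.ofReal (exp (-ω * x)) ∂μ =
      ENNReal.ofReal (1 / (1 + ∫ x, (1 - exp (-ω * x)) ∂ν)) := by
    intro ω hω
    have hi := integrable_exp_neg_mul hν hω
    set φ : ℝ := ∫ x, exp (-ω * x) ∂ν with hφ
    have hφ0 : 0 ≤ φ := integral_nonneg fun x => exp_nonneg _
    have hsub : ∫ x, (1 - exp (-ω * x)) ∂ν = c - φ := by
      rw [integral_sub (integrable_const _) hi]; simp [hc, hφ]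
    have hφc : φ ≤ c := by
      have : 0 ≤ ∫ x, (1 - exp (-ω * x)) ∂ν := by
        refine integral_nonneg_of_ae ?_
        filter_upwards [hν] with x hx
        simp only [Pi.zero_apply, sub_nonneg, exp_le_one_iff]
        nlinarith [mul_nonneg hω hx]
      linarith
    have hL : ∫⁻ x, ENNReal.ofReal (exp (-ω * x)) ∂ν = ENNReal.ofReal φ :=
      (ofReal_integral_eq_lintegral_ofReal hi (ae_of_all _ fun x => exp_nonneg _)).symm
    have hq : (1 + c)⁻¹ * φ < 1 := by
      rw [inv_mul_lt_iff₀ (by linarith)]; linarith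
    have h1c : (1 + c) ≠ 0 := by linarith
    rw [hμ, lintegral_smul_measure, lintegral_sum_measure]
    simp_rw [lintegral_smul_measure, lintegral_exp_convPow, hL, smul_eq_mul, ← mul_pow]
    rw [ENNReal.tsum_geometric, hr, ← ENNReal.ofReal_mul (by positivity), ← ENNReal.ofReal_one,
      ← ENNReal.ofReal_sub _ (by positivity), ← ENNReal.ofReal_inv_of_pos (by linarith),
      ← ENNReal.ofReal_mul (by positivity), hsub]
    congr 1
    have h2 : 1 + (c - φ) ≠ 0 := by linarith
    have h3 : 1 - (1 + c)⁻¹ * φ ≠ 0 := by linarith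
    rw [← mul_inv, one_div]
    congr 1
    field_simp
    ring
  refine ⟨μ, ⟨?_⟩, ?_, ?_⟩
  · simpa using key 0 le_rfl
  · refine Measure.ae_smul_measure ?_ r
    rw [Measure.ae_sum_iff]
    exact fun k => Measure.ae_smul_measure (ae_nonneg_convPow hν k) _
  · intro ω hω
    rw [integral_eq_lintegral_of_nonneg_ae (ae_of_all _ fun x => exp_nonneg _) (by fun_prop),
      key ω hω, ENNReal.toReal_ofReal]
    refine div_nonneg zero_le_one (add_nonneg zero_le_one (integral_nonneg_of_ae ?_))
    filter_upwards [hν] with x hx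
    simp only [Pi.zero_apply, sub_nonneg, exp_le_one_iff]
    nlinarith [mul_nonneg hω hx]

theorem measureReal_Ioi_le {μ : Measure ℝ} [IsProbabilityMeasure μ] (hμ : ∀ᵐ x ∂μ, 0 ≤ x)
    {R : ℝ} (hR : 0 < R) :
    μ.real (Set.Ioi R) ≤ 2 * (1 - ∫ x, exp (-R⁻¹ * x) ∂μ) := by
  have hi := integrable_exp_neg_mul hμ (inv_nonneg.2 hR.le)
  have hsub : ∫ x, (1 - exp (-R⁻¹ * x)) ∂μ = 1 - ∫ x, exp (-R⁻¹ * x) ∂μ := by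
    rw [integral_sub (integrable_const _) hi]; simp
  have hmarkov := mul_meas_ge_le_integral_of_nonneg (μ := μ)
    (f := fun x => 1 - exp (-R⁻¹ * x)) (by
      filter_upwards [hμ] with x hx
      simp only [Pi.zero_apply, sub_nonneg, exp_le_one_iff]
      nlinarith [mul_nonneg (inv_nonneg.2 hR.le) hx]) ((integrable_const _).sub hi) (1 / 2)
  have hsubset : Set.Ioi R ⊆ {x | 1 / 2 ≤ 1 - exp (-R⁻¹ * x)} := by
    intro x hx
    have h1 : exp (-R⁻¹ * x) ≤ exp (-1) := by
      rw [exp_le_exp, neg_mul, neg_le_neg_iff, ← div_eq_inv_mul, one_le_div hR]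
      exact (Set.mem_Ioi.1 hx).le
    have h2 : exp (-1) ≤ 1 / 2 := by
      rw [exp_neg, one_div]
      exact inv_anti₀ two_pos (by linarith [exp_one_gt_d9])
    simp only [Set.mem_ofPred_eq]
    linarith
  have := measureReal_mono (μ := μ) hsubset
  linarith

/-- A pointwise limit of Laplace transforms of probability measures on `[0, ∞)` is again one,
provided the transforms tend to `1` at `0` uniformly at a linear rate. -/
theorem exists_law_of_tendsto_laplace (μ : ℕ → Measure ℝ) [∀ n, IsProbabilityMeasure (μ n)]
    (hμ : ∀ n, ∀ᵐ x ∂(μ n), 0 ≤ x) (K : ℝ)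
    (hK : ∀ n ω, 0 ≤ ω → 1 - ∫ x, exp (-ω * x) ∂(μ n) ≤ K * ω) (L : ℝ → ℝ)
    (hL : ∀ ω, 0 ≤ ω → Tendsto (fun n => ∫ x, exp (-ω * x) ∂(μ n)) atTop (𝓝 (L ω))) :
    ∃ ρ : Measure ℝ, IsProbabilityMeasure ρ ∧ ρ (Set.Iio 0) = 0 ∧
      ∀ ω, 0 ≤ ω → ∫ x, exp (-ω * x) ∂ρ = L ω := by
  set u : ℕ → NNReal := fun n => Real.toNNReal (2 * K * (1 / ((n : ℝ) + 1))) with hu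
  have hu0 : Tendsto u atTop (𝓝 0) := by
    have := (tendsto_one_div_add_atTop_nhds_zero_nat (𝕜 := ℝ)).const_mul (2 * K)
    simpa [hu, Function.comp_def] using (continuous_real_toNNReal.tendsto _).comp this
  have hcomp := isCompact_setOfPred_probabilityMeasure_mass_eq_compl_isCompact_le (E := ℝ) hu0
    (K := fun n : ℕ => Set.Icc (0 : ℝ) (n + 1)) (fun n => isCompact_Icc) (Or.inl inferInstance)
  have hzero (n : ℕ) : μ n (Set.Iio 0) = 0 := by
    have := hμ n
    rw [ae_iff] at this
    simpa [Set.Iio] using this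
  set P : ℕ → ProbabilityMeasure ℝ := fun n => ⟨μ n, inferInstance⟩ with hP
  have hmem (m : ℕ) : P m ∈ {ρ : ProbabilityMeasure ℝ |
      ∀ n : ℕ, ρ (Set.Icc (0 : ℝ) (n + 1))ᶜ ≤ u n} := by
    intro n
    have hn : (0 : ℝ) < (n : ℝ) + 1 := by positivity
    have h1 : (μ m).real (Set.Icc (0 : ℝ) (n + 1))ᶜ ≤ 2 * K * (1 / ((n : ℝ) + 1)) := by
      have hcover : (Set.Icc (0 : ℝ) (n + 1))ᶜ ⊆ Set.Iio 0 ∪ Set.Ioi ((n : ℝ) + 1) := by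
        intro x hx
        by_contra h
        simp only [Set.mem_union, Set.mem_Iio, Set.mem_Ioi, not_or, not_lt] at h
        exact hx h
      have h2 := measureReal_mono (μ := μ m) hcover
      have h3 := measureReal_union_le (μ := μ m) (Set.Iio 0) (Set.Ioi ((n : ℝ) + 1))
      have h4 : (μ m).real (Set.Iio 0) = 0 := by simp [measureReal_def, hzero m]
      have h5 := measureReal_Ioi_le (hμ m) hn
      have h6 := hK m ((n : ℝ) + 1)⁻¹ (inv_nonneg.2 hn.le)
      rw [one_div]
      linarith
    rw [← NNReal.coe_le_coe]
    exact h1.trans (Real.le_coe_toNNReal _)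
  obtain ⟨ρ, hρ, hlim⟩ := hcomp.ultrafilter_le_nhds' ((hyperfilter ℕ : Ultrafilter ℕ).map P)
    (mem_map.2 (univ_mem' hmem))
  have hlim : Tendsto P (hyperfilter ℕ : Filter ℕ) (𝓝 ρ) := hlim
  have hρ0 : (ρ : Measure ℝ) (Set.Iio 0) = 0 := by
    have hle (n : ℕ) : ρ (Set.Iio 0) ≤ u n := by
      have hsub : Set.Iio (0 : ℝ) ⊆ (Set.Icc (0 : ℝ) (n + 1))ᶜ := fun x hx h => not_lt.2 h.1 hx
      exact (ρ.apply_mono hsub).trans (hρ n)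
    have h0 : ρ (Set.Iio 0) = 0 := le_antisymm (ge_of_tendsto' hu0 hle) zero_le
    rwa [ProbabilityMeasure.null_iff_toMeasure_null] at h0
  refine ⟨ρ, inferInstance, hρ0, fun ω hω => ?_⟩
  have hb (x : ℝ) : ‖exp (-ω * max x 0)‖ ≤ 1 := by
    rw [norm_of_nonneg (exp_nonneg _), exp_le_one_iff]
    nlinarith [mul_nonneg hω (le_max_right x 0)]
  let f : BoundedContinuousFunction ℝ ℝ :=
    BoundedContinuousFunction.ofNormedAddCommGroup (fun x => exp (-ω * max x 0))
      (by fun_prop) 1 hb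
  have hf {ν : Measure ℝ} (hν : ν (Set.Iio 0) = 0) : ∫ x, f x ∂ν = ∫ x, exp (-ω * x) ∂ν := by
    refine integral_congr_ae ?_
    have h0 : ∀ᵐ x ∂ν, 0 ≤ x := by
      rw [ae_iff]; simpa [Set.Iio] using hν
    filter_upwards [h0] with x hx
    simp [f, max_eq_left hx]
  have hconv := (ProbabilityMeasure.tendsto_iff_forall_integral_tendsto.1 hlim) f
  rw [hf hρ0] at hconv
  have heq : (fun n => ∫ x, f x ∂(P n : Measure ℝ)) = fun n => ∫ x, exp (-ω * x) ∂(μ n) :=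
    funext fun n => hf (hzero n)
  rw [heq] at hconv
  exact tendsto_nhds_unique hconv ((hL ω hω).mono_left Nat.hyperfilter_le_atTop)

theorem one_sub_exp_mul_rpow_nonneg {α ω u : ℝ} (hω : 0 ≤ ω) (hu : 0 < u) :
    0 ≤ (1 - exp (-ω * u)) * u ^ (-(1 + α)) := by
  refine mul_nonneg ?_ (rpow_nonneg hu.le _)
  rw [sub_nonneg, exp_le_one_iff]
  nlinarith [mul_nonneg hω hu.le]

theorem one_sub_exp_mul_rpow_le {α ω u : ℝ} (hu : 0 < u) :
    (1 - exp (-ω * u)) * u ^ (-(1 + α)) ≤ ω * u ^ (-α) := by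
  have h1 : 1 - exp (-ω * u) ≤ ω * u := by linarith [add_one_le_exp (-ω * u)]
  have h2 : u ^ (-α) = u * u ^ (-(1 + α)) := by
    conv_rhs => rw [← rpow_one u, ← rpow_mul hu.le, one_mul, ← rpow_add hu]
    ring_nf
  rw [h2, ← mul_assoc]
  exact mul_le_mul_of_nonneg_right h1 (rpow_nonneg hu.le _)

theorem intervalIntegrable_one_sub_exp_mul_rpow {α ω : ℝ} (hα1 : α < 1) (hω : 0 ≤ ω) :
    IntervalIntegrable (fun u => (1 - exp (-ω * u)) * u ^ (-(1 + α))) volume 0 1 := by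
  have hdom : IntervalIntegrable (fun u : ℝ => ω * u ^ (-α)) volume 0 1 :=
    (intervalIntegral.intervalIntegrable_rpow' (by linarith)).const_mul ω
  refine hdom.mono_fun (by fun_prop) ?_
  rw [Set.uIoc_of_le zero_le_one]
  filter_upwards [ae_restrict_mem measurableSet_Ioc] with u hu
  rw [norm_of_nonneg (one_sub_exp_mul_rpow_nonneg hω hu.1)]
  exact (one_sub_exp_mul_rpow_le hu.1).trans (le_abs_self _)

theorem Galpha_nonneg {α ω : ℝ} (hα0 : 0 ≤ α) (hω : 0 ≤ ω) : 0 ≤ Galpha α ω := by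
  rw [Galpha, intervalIntegral.integral_of_le zero_le_one]
  exact mul_nonneg hα0 (setIntegral_nonneg measurableSet_Ioc
    fun u hu => one_sub_exp_mul_rpow_nonneg hω hu.1)

theorem Galpha_le {α ω : ℝ} (hα0 : 0 ≤ α) (hα1 : α < 1) (hω : 0 ≤ ω) :
    Galpha α ω ≤ α / (1 - α) * ω := by
  have hdom : IntervalIntegrable (fun u : ℝ => ω * u ^ (-α)) volume 0 1 :=
    (intervalIntegral.intervalIntegrable_rpow' (by linarith)).const_mul ω
  have hle : ∫ u in (0 : ℝ)..1, (1 - exp (-ω * u)) * u ^ (-(1 + α)) ≤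
      ∫ u in (0 : ℝ)..1, ω * u ^ (-α) :=
    intervalIntegral.integral_mono_on_of_le_Ioo zero_le_one
      (intervalIntegrable_one_sub_exp_mul_rpow hα1 hω) hdom
      fun u hu => one_sub_exp_mul_rpow_le hu.1
  have hval : ∫ u in (0 : ℝ)..1, ω * u ^ (-α) = ω / (1 - α) := by
    rw [intervalIntegral.integral_const_mul, integral_rpow (Or.inl (by linarith)), one_rpow,
      zero_rpow (by linarith)]
    ring_nf
  rw [hval] at hle
  calc Galpha α ω ≤ α * (ω / (1 - α)) := mul_le_mul_of_nonneg_left hle hα0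
    _ = α / (1 - α) * ω := by ring

/-- The restriction of the Lévy measure `α u^{-(1+α)} du` to `(ε, 1]`. -/
noncomputable def truncatedLevy (α ε : ℝ) : Measure ℝ :=
  (volume.restrict (Set.Ioc ε 1)).withDensity fun u => ENNReal.ofReal (α * u ^ (-(1 + α)))

theorem isFiniteMeasure_truncatedLevy (α : ℝ) {ε : ℝ} (hε : 0 < ε) :
    IsFiniteMeasure (truncatedLevy α ε) := by
  refine isFiniteMeasure_withDensity_ofReal (Integrable.hasFiniteIntegral ?_)
  have hcont : ContinuousOn (fun u : ℝ => α * u ^ (-(1 + α))) (Set.Icc ε 1) := fun u hu =>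
    ((continuousAt_rpow_const u _
      (Or.inl (hε.trans_le hu.1).ne')).const_mul α).continuousWithinAt
  exact hcont.integrableOn_Icc.mono_set Set.Ioc_subset_Icc_self

theorem ae_nonneg_truncatedLevy (α : ℝ) {ε : ℝ} (hε : 0 < ε) :
    ∀ᵐ x ∂(truncatedLevy α ε), 0 ≤ x := by
  refine (withDensity_absolutelyContinuous _ _).ae_le ?_
  filter_upwards [ae_restrict_mem measurableSet_Ioc] with x hx
  exact (hε.trans hx.1).le

theorem integral_truncatedLevy {α ε : ℝ} (hα0 : 0 ≤ α) (hε : 0 < ε) (hε1 : ε ≤ 1) (ω : ℝ) :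
    ∫ x, (1 - exp (-ω * x)) ∂(truncatedLevy α ε) =
      α * ∫ u in ε..1, (1 - exp (-ω * u)) * u ^ (-(1 + α)) := by
  rw [truncatedLevy, integral_withDensity_eq_integral_toReal_smul (by fun_prop) (by simp),
    intervalIntegral.integral_of_le hε1, ← integral_const_mul]
  refine setIntegral_congr_fun measurableSet_Ioc fun u hu => ?_
  have hu0 : 0 < u := hε.trans hu.1
  simp only [smul_eq_mul]
  rw [ENNReal.toReal_ofReal (mul_nonneg hα0 (rpow_nonneg hu0.le _))]
  ring

/-- Existence of the probability law 𝒢_α: a Borel probability measure supported on `[0,∞)`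
whose Laplace transform is `1/(1 + G_α)` (equation (4.10)). -/
theorem exists_G_alpha_law (α : ℝ) (hα0 : 0 < α) (hα1 : α < 1) :
    ∃ μ : Measure ℝ, IsProbabilityMeasure μ ∧ μ (Set.Iio 0) = 0 ∧
      ∀ ω : ℝ, 0 ≤ ω → (∫ x, Real.exp (-ω * x) ∂μ) = 1 / (1 + Galpha α ω) := by
  set ε : ℕ → ℝ := fun n => 1 / ((n : ℝ) + 1) with hε
  have hε0 (n : ℕ) : 0 < ε n := Nat.one_div_pos_of_nat
  have hε1 (n : ℕ) : ε n ≤ 1 := by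
    rw [hε]; exact div_le_one_of_le₀ (by simp) (by positivity)
  have hεlim : Tendsto ε atTop (𝓝 0) := tendsto_one_div_add_atTop_nhds_zero_nat
  have hex (n : ℕ) := by
    have := isFiniteMeasure_truncatedLevy α (hε0 n)
    exact exists_law_of_isFiniteMeasure _ (ae_nonneg_truncatedLevy α (hε0 n))
  choose μ hprob hnonneg hlaplace using hex
  simp_rw [integral_truncatedLevy hα0.le (hε0 _) (hε1 _)] at hlaplace
  set G : ℕ → ℝ → ℝ := fun n ω => α * ∫ u in ε n..1, (1 - exp (-ω * u)) * u ^ (-(1 + α)) with hG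
  have hG0 (n : ℕ) {ω : ℝ} (hω : 0 ≤ ω) : 0 ≤ G n ω := by
    refine mul_nonneg hα0.le ?_
    rw [intervalIntegral.integral_of_le (hε1 n)]
    exact setIntegral_nonneg measurableSet_Ioc
      fun u hu => one_sub_exp_mul_rpow_nonneg hω ((hε0 n).trans hu.1)
  have hGle (n : ℕ) {ω : ℝ} (hω : 0 ≤ ω) : G n ω ≤ Galpha α ω := by
    refine mul_le_mul_of_nonneg_left ?_ hα0.le
    refine intervalIntegral.integral_mono_interval (hε0 n).le (hε1 n) le_rfl ?_
      (intervalIntegrable_one_sub_exp_mul_rpow hα1 hω)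
    filter_upwards [ae_restrict_mem measurableSet_Ioc] with u hu
    exact one_sub_exp_mul_rpow_nonneg hω hu.1
  have hGlim {ω : ℝ} (hω : 0 ≤ ω) : Tendsto (fun n => G n ω) atTop (𝓝 (Galpha α ω)) := by
    refine Tendsto.const_mul α ?_
    have hcont := intervalIntegral.continuousOn_primitive_interval_left
      (μ := volume) (a := 0) (b := 1) (f := fun u => (1 - exp (-ω * u)) * u ^ (-(1 + α)))
      (by
        rw [Set.uIcc_of_le zero_le_one, integrableOn_Icc_iff_integrableOn_Ioc]
        exact (intervalIntegrable_iff_integrableOn_Ioc_of_le zero_le_one).1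
          (intervalIntegrable_one_sub_exp_mul_rpow hα1 hω))
    refine (hcont 0 Set.left_mem_uIcc).tendsto.comp
      (tendsto_nhdsWithin_iff.2 ⟨hεlim, Eventually.of_forall fun n => ?_⟩)
    rw [Set.uIcc_of_le zero_le_one]
    exact ⟨(hε0 n).le, hε1 n⟩
  refine exists_law_of_tendsto_laplace μ hnonneg (α / (1 - α)) (fun n ω hω => ?_)
    (fun ω => 1 / (1 + Galpha α ω)) fun ω hω => ?_
  · rw [hlaplace n ω hω]
    have h0 := hG0 n hω
    have h1 : 1 - 1 / (1 + G n ω) ≤ G n ω := by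
      rw [sub_le_iff_le_add, ← sub_le_iff_le_add', le_div_iff₀ (by linarith)]
      nlinarith
    exact h1.trans ((hGle n hω).trans (Galpha_le hα0.le hα1 hω))
  · simp_rw [fun n => hlaplace n ω hω]
    have := Galpha_nonneg hα0.le hω
    exact tendsto_const_nhds.div ((hGlim hω).const_add 1) (by linarith)
end
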